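/- arXiv:2507.11816 — 5 statements merged into one kernel-verified Lean document; each statement's English description precedes it below -/
import Mathlib

section
/- Let 𝒳 be a measurable space carrying two probability measures μ₀ (null hypothesis H₀) and μ₁ (alternative H₁). Let T_N : 𝒳 → ℝ and A : 𝒳 → 𝒜 be measurable statistics (𝒜 a measurable space), and let ψ : ℝ × 𝒜 → ℝ be measurable; define the test statistic T(x) = ψ(T_N(x), A(x)). Assume: (i) A is ancillary, i.e. the pushforward laws of A under μ₀ and μ₁ coincide; (ii) T_N and A are independent under μ₀ and under μ₁; (iii) there is a strictly increasing function L : ℝ → (0,∞) such that the law ν₁ of L∘T_N under μ₁ satisfies ν₁(B) = ∫_B u dν₀(u) for every Borel set B ⊆ ℝ, where ν₀ is the law of L∘T_N under μ₀. Then for all thresholds c, c′ ∈ ℝ with μ₀{x : T_N(x) ≥ c} = μ₀{x : T(x) ≥ c′}, one has μ₁{x : T_N(x) ≥ c} ≥ μ₁{x : T(x) ≥ c′}. (Proposition 1: the test rejecting for large T_N dominates the test based on T in power at every matched level.) -/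
open MeasureTheory ProbabilityTheory

/-- Neyman–Pearson: among measurable sets of a given finite measure, a superlevel set of the density
maximises the measure with that density. -/
theorem withDensity_apply_le_of_superlevel {α : Type*} [MeasurableSpace α] {μ : Measure α}
    [IsFiniteMeasure μ] {f : α → ENNReal} {k : ENNReal} {R E : Set α}
    (hR : MeasurableSet R) (hE : MeasurableSet E)
    (hfR : ∀ x ∈ R, k ≤ f x) (hfRc : ∀ x, x ∉ R → f x ≤ k) (h : μ R = μ E) :
    μ.withDensity f E ≤ μ.withDensity f R := by
  have hdiff : μ (R \ E) = μ (E \ R) := by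
    have h1 := measure_inter_add_sdiff (μ := μ) E hR
    have h2 := measure_inter_add_sdiff (μ := μ) R hE
    rw [← h, ← h2, Set.inter_comm] at h1
    exact ((ENNReal.add_right_inj (measure_ne_top μ _)).1 h1).symm
  rw [← measure_inter_add_sdiff E hR, ← measure_inter_add_sdiff R hE, Set.inter_comm R E]
  refine add_le_add le_rfl ?_
  rw [withDensity_apply _ (hE.diff hR), withDensity_apply _ (hR.diff hE)]
  calc ∫⁻ x in E \ R, f x ∂μ ≤ ∫⁻ _ in E \ R, k ∂μ :=
        setLIntegral_mono measurable_const fun x hx => hfRc x hx.2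
    _ = ∫⁻ _ in R \ E, k ∂μ := by simp only [setLIntegral_const, hdiff]
    _ ≤ ∫⁻ x in R \ E, f x ∂μ :=
        setLIntegral_mono' (hR.diff hE) fun x hx => hfR x hx.1

/-- If the law of `L ∘ X` under `μ₁` has density `u ↦ u` with respect to its law under `μ₀`,
where `L` is positive and injective, then `L` is the density of the law of `X`. -/
theorem map_eq_withDensity_of_likelihoodRatio {Ω : Type*} [MeasurableSpace Ω]
    {μ₀ μ₁ : Measure Ω} [IsFiniteMeasure μ₁]
    {X : Ω → ℝ} (hX : Measurable X) {L : ℝ → ℝ} (hL : Measurable L)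
    (hLinj : Function.Injective L) (hLpos : ∀ u, 0 < L u)
    (hLint : Integrable (fun x => L (X x)) μ₀)
    (hdens : ∀ B : Set ℝ, MeasurableSet B →
      ((μ₁.map (fun x => L (X x))) B).toReal = ∫ u in B, u ∂(μ₀.map (fun x => L (X x)))) :
    μ₁.map X = (μ₀.map X).withDensity (fun t => ENNReal.ofReal (L t)) := by
  have hLX : Measurable fun x => L (X x) := hL.comp hX
  ext B hB
  have hLB : MeasurableSet (L '' B) := (hL.measurableEmbedding hLinj).measurableSet_image' hB
  have hpre : (fun x => L (X x)) ⁻¹' (L '' B) = X ⁻¹' B := by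
    ext x
    simp [hLinj.eq_iff]
  have h := hdens _ hLB
  rw [Measure.map_apply hLX hLB, hpre,
    setIntegral_map hLB (by fun_prop) hLX.aemeasurable, hpre] at h
  rw [Measure.map_apply hX hB, withDensity_apply _ hB,
    setLIntegral_map hB (by fun_prop) hX, ← ENNReal.ofReal_toReal (measure_ne_top μ₁ (X ⁻¹' B)), h,
    ofReal_integral_eq_lintegral_ofReal hLint.integrableOn
      (Filter.Eventually.of_forall fun x => (hLpos _).le)]

/-- Proposition 1: if the test statistic `T = ψ (T_N, A)` is built from a statistic `T_N`
that is independent of an ancillary statistic `A` under both hypotheses, and there is a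
strictly increasing positive `L` such that the law of `L ∘ T_N` under `μ₁` has density
`u ↦ u` with respect to its law under `μ₀`, then the test rejecting for large `T_N`
dominates the test based on `T` in power at every matched level. -/
theorem prop1_dominates
    {𝒳 𝒜 : Type*} [MeasurableSpace 𝒳] [MeasurableSpace 𝒜]
    (μ₀ μ₁ : Measure 𝒳) [IsProbabilityMeasure μ₀] [IsProbabilityMeasure μ₁]
    (TN : 𝒳 → ℝ) (A : 𝒳 → 𝒜) (ψ : ℝ × 𝒜 → ℝ)
    (hTN : Measurable TN) (hA : Measurable A) (hψ : Measurable ψ)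
    (T : 𝒳 → ℝ) (hT : ∀ x, T x = ψ (TN x, A x))
    (hanc : μ₀.map A = μ₁.map A)
    (hind0 : IndepFun TN A μ₀) (hind1 : IndepFun TN A μ₁)
    (L : ℝ → ℝ) (hLmono : StrictMono L) (hLpos : ∀ u, 0 < L u)
    (hLint : Integrable (fun x => L (TN x)) μ₀)
    (hdens : ∀ B : Set ℝ, MeasurableSet B →
      ((μ₁.map (fun x => L (TN x))) B).toReal
        = ∫ u in B, u ∂(μ₀.map (fun x => L (TN x))))
    (c c' : ℝ)
    (hlevel : μ₀ {x | c ≤ TN x} = μ₀ {x | c' ≤ T x}) :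
    μ₁ {x | c' ≤ T x} ≤ μ₁ {x | c ≤ TN x} := by
  have hL : Measurable L := hLmono.monotone.measurable
  have hTA : Measurable fun x => (TN x, A x) := hTN.prodMk hA
  have : IsProbabilityMeasure (μ₀.map A) := Measure.isProbabilityMeasure_map hA.aemeasurable
  have : IsProbabilityMeasure (μ₀.map TN) := Measure.isProbabilityMeasure_map hTN.aemeasurable
  have hjoint : μ₁.map (fun x => (TN x, A x)) =
      (μ₀.map fun x => (TN x, A x)).withDensity fun p => ENNReal.ofReal (L p.1) := by
    rw [(indepFun_iff_map_prod_eq_prod_map_map hTN.aemeasurable hA.aemeasurable).1 hind0,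
      (indepFun_iff_map_prod_eq_prod_map_map hTN.aemeasurable hA.aemeasurable).1 hind1, ← hanc,
      map_eq_withDensity_of_likelihoodRatio hTN hL hLmono.injective hLpos hLint hdens,
      prod_withDensity_left (by fun_prop)]
  have : IsProbabilityMeasure (μ₀.map fun x => (TN x, A x)) :=
    Measure.isProbabilityMeasure_map hTA.aemeasurable
  have hR : MeasurableSet {p : ℝ × 𝒜 | c ≤ p.1} := measurableSet_le measurable_const measurable_fst
  have hE : MeasurableSet {p : ℝ × 𝒜 | c' ≤ ψ p} := measurableSet_le measurable_const hψ
  have hRpre : {x | c ≤ TN x} = (fun x => (TN x, A x)) ⁻¹' {p | c ≤ p.1} := rfl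
  have hEpre : {x | c' ≤ T x} = (fun x => (TN x, A x)) ⁻¹' {p | c' ≤ ψ p} := by
    ext x
    simp [hT]
  rw [hRpre, hEpre, ← Measure.map_apply hTA hR, ← Measure.map_apply hTA hE] at hlevel ⊢
  rw [hjoint]
  refine withDensity_apply_le_of_superlevel (k := ENNReal.ofReal (L c)) hR hE
    (fun p hp => ENNReal.ofReal_le_ofReal (hLmono.monotone hp)) (fun p hp => ?_) hlevel
  exact ENNReal.ofReal_le_ofReal (hLmono.monotone (not_le.1 hp).le)
end

section
/- Let 𝒳 be a measurable space carrying two probability measures μ₀ (null hypothesis H₀) and μ₁ (alternative H₁). Let T_N : 𝒳 → ℝ and V : 𝒳 → 𝒱 be measurable statistics such that the map x ↦ (T_N(x), V(x)) is injective with a measurable inverse (there is a measurable Φ : ℝ × 𝒱 → 𝒳 with Φ(T_N(x), V(x)) = x for all x). Assume: (i) V is ancillary, i.e. the pushforward laws of V under μ₀ and μ₁ coincide; (ii) T_N and V are independent under μ₀ and under μ₁; (iii) there is a strictly increasing function L : ℝ → (0,∞) such that the law ν₁ of L∘T_N under μ₁ satisfies ν₁(B) = ∫_B u dν₀(u) for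 every Borel B ⊆ ℝ, where ν₀ is the law of L∘T_N under μ₀. Then T_N is a most powerful test statistic: for every c ∈ ℝ and every measurable rejection region R ⊆ 𝒳 with μ₀(R) = μ₀{x : T_N(x) ≥ c}, one has μ₁(R) ≤ μ₁{x : T_N(x) ≥ c}. (Proposition 2.) -/
open MeasureTheory ProbabilityTheory
open scoped ENNReal

/-- A Neyman–Pearson lemma: for the measure with density `f` against `μ`, a set on which `f ≥ k` and off which `f ≤ k`
has the largest measure among all sets with the same `μ`-measure. -/
theorem withDensity_le_of_measure_eq {α : Type*} [MeasurableSpace α] (μ : Measure α)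
    [IsFiniteMeasure μ] (f : α → ℝ≥0∞) (k : ℝ≥0∞) {A R : Set α}
    (hA : MeasurableSet A) (hR : MeasurableSet R)
    (hle : ∀ x ∈ A, k ≤ f x) (hge : ∀ x ∉ A, f x ≤ k) (h : μ R = μ A) :
    μ.withDensity f R ≤ μ.withDensity f A := by
  have hdiff : μ (R \ A) = μ (A \ R) :=
    measure_sdiff_symm hR.nullMeasurableSet hA.nullMeasurableSet h (measure_ne_top μ _)
  have key : μ.withDensity f (R \ A) ≤ μ.withDensity f (A \ R) := by
    rw [withDensity_apply _ (hR.diff hA), withDensity_apply _ (hA.diff hR)]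
    calc ∫⁻ x in R \ A, f x ∂μ ≤ ∫⁻ _ in R \ A, k ∂μ :=
          setLIntegral_mono' (hR.diff hA) fun x hx => hge x hx.2
      _ = ∫⁻ _ in A \ R, k ∂μ := by rw [setLIntegral_const, setLIntegral_const, hdiff]
      _ ≤ ∫⁻ x in A \ R, f x ∂μ :=
          setLIntegral_mono' (hA.diff hR) fun x hx => hle x hx.1
  rw [← measure_inter_add_sdiff R hA, ← measure_inter_add_sdiff A hR, Set.inter_comm]
  gcongr

/-- Pulling a density back along a measurable map with a measurable left inverse. -/
theorem eq_withDensity_comp_of_map_eq {α β : Type*} [MeasurableSpace α] [MeasurableSpace β]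
    {μ ν : Measure α} {g : α → β} (hg : Measurable g) {h : β → α} (hh : Measurable h)
    (hinv : Function.LeftInverse h g) {f : β → ℝ≥0∞} (hf : Measurable f)
    (hmap : ν.map g = (μ.map g).withDensity f) : ν = μ.withDensity (f ∘ g) := by
  ext s hs
  have hpre : g ⁻¹' (h ⁻¹' s) = s := by ext x; simp [hinv x]
  calc ν s = ν.map g (h ⁻¹' s) := by rw [Measure.map_apply hg (hh hs), hpre]
    _ = μ.withDensity (f ∘ g) s := by
      rw [hmap, withDensity_apply _ (hh hs), setLIntegral_map (hh hs) hf hg, hpre,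
        withDensity_apply _ hs]
      rfl

/-- A finite measure given by the real set integrals of a nonnegative function has that
function as its density. -/
theorem eq_withDensity_ofReal_of_toReal_eq {α : Type*} [MeasurableSpace α] {μ ν : Measure α}
    [IsFiniteMeasure ν] {f : α → ℝ} (hf : Integrable f μ) (hf0 : 0 ≤ᵐ[μ] f)
    (h : ∀ s, MeasurableSet s → (ν s).toReal = ∫ x in s, f x ∂μ) :
    ν = μ.withDensity fun x => ENNReal.ofReal (f x) := by
  ext s hs
  rw [withDensity_apply _ hs, ← ofReal_integral_eq_lintegral_ofReal hf.restrict
    (ae_restrict_of_ae hf0), ← h s hs, ENNReal.ofReal_toReal (measure_ne_top ν s)]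

/-- Proposition 2: if the data can be measurably reconstructed from `(T_N, V)`, `V` is
ancillary, `T_N` is independent of `V` under both hypotheses, and there is a strictly
increasing positive `L` such that the law of `L ∘ T_N` under `μ₁` has density `u ↦ u`
with respect to its law under `μ₀`, then `T_N` is a most powerful test statistic. -/
theorem prop2_most_powerful
    {𝒳 𝒱 : Type*} [MeasurableSpace 𝒳] [MeasurableSpace 𝒱]
    (μ₀ μ₁ : Measure 𝒳) [IsProbabilityMeasure μ₀] [IsProbabilityMeasure μ₁]
    (TN : 𝒳 → ℝ) (V : 𝒳 → 𝒱) (hTN : Measurable TN) (hV : Measurable V)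
    (Φ : ℝ × 𝒱 → 𝒳) (hΦ : Measurable Φ) (hinv : ∀ x, Φ (TN x, V x) = x)
    (hanc : μ₀.map V = μ₁.map V)
    (hind0 : IndepFun TN V μ₀) (hind1 : IndepFun TN V μ₁)
    (L : ℝ → ℝ) (hLmono : StrictMono L) (hLpos : ∀ u, 0 < L u)
    (hLint : Integrable (fun x => L (TN x)) μ₀)
    (hdens : ∀ B : Set ℝ, MeasurableSet B →
      ((μ₁.map (fun x => L (TN x))) B).toReal
        = ∫ u in B, u ∂(μ₀.map (fun x => L (TN x)))) :
    ∀ c : ℝ, ∀ R : Set 𝒳, MeasurableSet R →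
      μ₀ R = μ₀ {x | c ≤ TN x} → μ₁ R ≤ μ₁ {x | c ≤ TN x} := by
  have hL : Measurable L := hLmono.monotone.measurable
  have hLT : Measurable fun x => L (TN x) := hL.comp hTN
  have hf : Measurable fun u => ENNReal.ofReal (L u) := hL.ennreal_ofReal
  have : IsProbabilityMeasure (μ₀.map TN) := Measure.isProbabilityMeasure_map hTN.aemeasurable
  have : IsProbabilityMeasure (μ₁.map TN) := Measure.isProbabilityMeasure_map hTN.aemeasurable
  have : IsProbabilityMeasure (μ₀.map V) := Measure.isProbabilityMeasure_map hV.aemeasurable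
  have hlawL : μ₁.map (fun x => L (TN x))
      = (μ₀.map fun x => L (TN x)).withDensity fun u => ENNReal.ofReal u := by
    have hint : Integrable (fun u : ℝ => u) (μ₀.map fun x => L (TN x)) :=
      (integrable_map_measure measurable_id.aestronglyMeasurable hLT.aemeasurable).2 hLint
    have hpos : ∀ᵐ u ∂(μ₀.map fun x => L (TN x)), 0 ≤ u :=
      (ae_map_iff hLT.aemeasurable measurableSet_Ici).2 (.of_forall fun x => (hLpos _).le)
    have : IsProbabilityMeasure (μ₁.map fun x => L (TN x)) :=
      Measure.isProbabilityMeasure_map hLT.aemeasurable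
    exact eq_withDensity_ofReal_of_toReal_eq hint hpos hdens
  have hlaw : μ₁.map TN = (μ₀.map TN).withDensity fun u => ENNReal.ofReal (L u) := by
    have hemb : MeasurableEmbedding L := hL.measurableEmbedding hLmono.injective
    have hmap : (μ₁.map TN).map L = ((μ₀.map TN).map L).withDensity ENNReal.ofReal := by
      rw [Measure.map_map hL hTN, Measure.map_map hL hTN]
      exact hlawL
    have hcomp := eq_withDensity_comp_of_map_eq hL hemb.measurable_invFun
      hemb.leftInverse_invFun ENNReal.measurable_ofReal hmap
    exact hcomp
  have hjoint : μ₁.map (fun x => (TN x, V x))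
      = (μ₀.map fun x => (TN x, V x)).withDensity fun p => ENNReal.ofReal (L p.1) := by
    rw [(indepFun_iff_map_prod_eq_prod_map_map hTN.aemeasurable hV.aemeasurable).1 hind1,
      (indepFun_iff_map_prod_eq_prod_map_map hTN.aemeasurable hV.aemeasurable).1 hind0,
      ← hanc, hlaw, prod_withDensity_left hf]
  have hμ := eq_withDensity_comp_of_map_eq (hTN.prodMk hV) hΦ hinv (hf.comp measurable_fst) hjoint
  intro c R hR h
  rw [hμ]
  exact withDensity_le_of_measure_eq μ₀ _ (ENNReal.ofReal (L c))
    (measurableSet_le measurable_const hTN) hR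
    (fun x hx => ENNReal.ofReal_le_ofReal (hLmono.monotone hx))
    (fun x hx => ENNReal.ofReal_le_ofReal (hLmono.monotone (not_le.1 hx).le)) h
end

section
/- Fix n ≥ 1, σ > 0 and μ₁ > 0. For θ ∈ ℝ let P_θ denote the n-fold product on ℝⁿ of the Gaussian measure N(θ, σ²). Then the test based on the sample sum is most powerful for testing θ = 0 against θ = μ₁: for every c ∈ ℝ and every measurable set R ⊆ ℝⁿ with P₀(R) = P₀{x ∈ ℝⁿ : ∑_{i=1}^n x_i ≥ c}, one has P_{μ₁}(R) ≤ P_{μ₁}{x ∈ ℝⁿ : ∑_{i=1}^n x_i ≥ c}. -/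
open MeasureTheory ProbabilityTheory

open scoped ENNReal NNReal

/-- The Neyman–Pearson lemma for a non-randomized likelihood ratio test. -/
theorem neyman_pearson_withDensity {Ω : Type*} [MeasurableSpace Ω] (P : Measure Ω)
    [IsFiniteMeasure P] {f : Ω → ℝ≥0∞} (k : ℝ≥0∞) {A R : Set Ω}
    (hA : MeasurableSet A) (hR : MeasurableSet R) (hkA : ∀ x ∈ A, k ≤ f x)
    (hkAc : ∀ x ∉ A, f x ≤ k) (h : P R = P A) :
    P.withDensity f R ≤ P.withDensity f A := by
  have hdiff : P (R \ A) = P (A \ R) := by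
    rw [← measure_inter_add_sdiff R hA, ← measure_inter_add_sdiff A hR, Set.inter_comm A R] at h
    exact (ENNReal.add_right_inj (measure_ne_top P _)).1 h
  have key : P.withDensity f (R \ A) ≤ P.withDensity f (A \ R) := by
    rw [withDensity_apply _ (hR.diff hA), withDensity_apply _ (hA.diff hR)]
    calc ∫⁻ x in R \ A, f x ∂P ≤ ∫⁻ _ in R \ A, k ∂P :=
          setLIntegral_mono measurable_const fun x hx => hkAc x hx.2
      _ = ∫⁻ _ in A \ R, k ∂P := by simp only [setLIntegral_const, hdiff]
      _ ≤ ∫⁻ x in A \ R, f x ∂P := setLIntegral_mono' (hA.diff hR) fun x hx => hkA x hx.1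
  rw [← measure_inter_add_sdiff R hA, ← measure_inter_add_sdiff A hR, Set.inter_comm A R]
  gcongr

/-- A product of probability measures with densities has the product density. -/
theorem pi_withDensity_eq {ι : Type*} [Fintype ι] {X : ι → Type*} [∀ i, MeasurableSpace (X i)]
    (P : ∀ i, Measure (X i)) [∀ i, IsProbabilityMeasure (P i)] {f : ∀ i, X i → ℝ≥0∞}
    (hf : ∀ i, Measurable (f i)) [∀ i, SigmaFinite ((P i).withDensity (f i))] :
    Measure.pi (fun i => (P i).withDensity (f i))
      = (Measure.pi P).withDensity fun x => ∏ i, f i (x i) := by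
  refine Measure.pi_eq fun s hs => ?_
  rw [withDensity_apply _ (MeasurableSet.univ_pi hs),
    ← lintegral_indicator (MeasurableSet.univ_pi hs)]
  have hg : ∀ i, Measurable ((s i).indicator (f i)) := fun i => (hf i).indicator (hs i)
  have hind : (Set.univ.pi s).indicator (fun x => ∏ i, f i (x i))
      = fun x => ∏ i, (s i).indicator (f i) (x i) := by
    ext x
    by_cases hx : x ∈ Set.univ.pi s
    · rw [Set.indicator_of_mem hx]
      exact Finset.prod_congr rfl fun i _ =>
        (Set.indicator_of_mem (hx i (Set.mem_univ i)) _).symm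
    · rw [Set.indicator_of_notMem hx]
      obtain ⟨i, hi⟩ : ∃ i, x i ∉ s i := by simpa using hx
      exact (Finset.prod_eq_zero (Finset.mem_univ i) (Set.indicator_of_notMem hi _)).symm
  rw [hind, lintegral_prod_eq_prod_lintegral_of_indepFun Finset.univ
    (fun i (x : ∀ i, X i) => (s i).indicator (f i) (x i))
    (iIndepFun_pi fun i => (hg i).aemeasurable) fun i => (hg i).comp (measurable_pi_apply i)]
  refine Finset.prod_congr rfl fun i _ => ?_
  rw [(measurePreserving_eval P i).lintegral_comp (hg i), lintegral_indicator (hs i),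
    withDensity_apply _ (hs i)]

/-- The likelihood ratio of `N(μ, v)` with respect to `N(0, v)`. -/
theorem gaussianReal_eq_withDensity_gaussianReal_zero (μ : ℝ) {v : ℝ≥0} (hv : v ≠ 0) :
    gaussianReal μ v = (gaussianReal 0 v).withDensity
      fun x => ENNReal.ofReal (Real.exp ((μ * x - μ ^ 2 / 2) / v)) := by
  rw [gaussianReal_of_var_ne_zero 0 hv, gaussianReal_of_var_ne_zero μ hv,
    ← withDensity_mul _ (measurable_gaussianPDF 0 v) (by fun_prop)]
  congr 1
  ext x
  have hv' : (v : ℝ) ≠ 0 := by exact_mod_cast hv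
  rw [Pi.mul_apply, gaussianPDF, gaussianPDF,
    ← ENNReal.ofReal_mul (gaussianPDFReal_nonneg 0 v x), gaussianPDFReal, gaussianPDFReal,
    mul_assoc _ (Real.exp _) (Real.exp _), ← Real.exp_add]
  congr 3
  field_simp
  ring

/-- Forward content of Proposition 4: for i.i.d. `N(θ, σ²)` observations with known
variance, the test based on the sample sum is most powerful for testing `θ = 0` against
`θ = μ₁ > 0`: any rejection region with the same null probability as
`{x : ∑ xᵢ ≥ c}` has alternative probability at most that of `{x : ∑ xᵢ ≥ c}`. -/
theorem gaussian_sum_most_powerful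
    (n : ℕ) (hn : 1 ≤ n) (σ : ℝ) (hσ : 0 < σ) (μ₁ : ℝ) (hμ₁ : 0 < μ₁) :
    ∀ c : ℝ, ∀ R : Set (Fin n → ℝ), MeasurableSet R →
      Measure.pi (fun _ : Fin n => gaussianReal 0 ⟨σ ^ 2, sq_nonneg σ⟩) R
        = Measure.pi (fun _ : Fin n => gaussianReal 0 ⟨σ ^ 2, sq_nonneg σ⟩)
            {x | c ≤ ∑ i, x i} →
      Measure.pi (fun _ : Fin n => gaussianReal μ₁ ⟨σ ^ 2, sq_nonneg σ⟩) R
        ≤ Measure.pi (fun _ : Fin n => gaussianReal μ₁ ⟨σ ^ 2, sq_nonneg σ⟩)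
            {x | c ≤ ∑ i, x i} := by
  intro c R hR h
  set v : ℝ≥0 := ⟨σ ^ 2, sq_nonneg σ⟩
  have hvpos : 0 < v := by
    rw [← NNReal.coe_pos]
    exact pow_pos hσ 2
  have hL := gaussianReal_eq_withDensity_gaussianReal_zero μ₁ hvpos.ne'
  set L : ℝ → ℝ≥0∞ := fun x => ENNReal.ofReal (Real.exp ((μ₁ * x - μ₁ ^ 2 / 2) / v)) with hLdef
  have : SigmaFinite ((gaussianReal 0 v).withDensity L) := hL ▸ inferInstance
  have hprod (x : Fin n → ℝ) : ∏ i, L (x i)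
      = ENNReal.ofReal (Real.exp ((μ₁ * ∑ i, x i - n * (μ₁ ^ 2 / 2)) / v)) := by
    rw [hLdef, ← ENNReal.ofReal_prod_of_nonneg fun _ _ => (Real.exp_pos _).le, ← Real.exp_sum,
      ← Finset.sum_div, Finset.sum_sub_distrib, Finset.mul_sum]
    simp
  rw [hL, pi_withDensity_eq (fun _ : Fin n => gaussianReal 0 v) (f := fun _ => L)
    fun _ => by fun_prop]
  refine neyman_pearson_withDensity _
    (ENNReal.ofReal (Real.exp ((μ₁ * c - n * (μ₁ ^ 2 / 2)) / v)))
    (measurableSet_le measurable_const (by fun_prop)) hR (fun x hx => ?_) (fun x hx => ?_) h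
  · rw [hprod]
    have hx : c ≤ ∑ i, x i := hx
    gcongr
  · rw [hprod]
    have hx : ∑ i, x i ≤ c := (not_le.1 hx).le
    gcongr
end

section
/- Let Δ and R be real random variables on a probability space, let κ > 0 be a constant and n ≥ 1 an integer. Assume Δ ≥ −κ almost surely, E[R] = 0, E[R²] < ∞ and E[Δ⁶] < ∞. Then |E[√(n(Δ + κ)) · R] − √n · E[(Δ/(2√κ) − Δ²/(8κ^{3/2})) · R]| ≤ √n · κ^{−5/2} · √(E[Δ⁶] · E[R²]). -/
open MeasureTheory

/-- Second-order Taylor bound for the square root at `a ^ 2`. -/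
lemma abs_sqrt_add_sq_sub_taylor_le {a x : ℝ} (ha : 0 < a) (hx : -a ^ 2 ≤ x) :
    |Real.sqrt (x + a ^ 2) - a - (x / (2 * a) - x ^ 2 / (8 * a ^ 3))|
      ≤ (a ^ 5)⁻¹ * |x ^ 3| := by
  obtain ⟨t, ht, ht0⟩ : ∃ t, Real.sqrt (x + a ^ 2) = t ∧ 0 ≤ t :=
    ⟨_, rfl, Real.sqrt_nonneg _⟩
  have hsq : t ^ 2 = x + a ^ 2 := by rw [← ht, Real.sq_sqrt (by linarith)]
  obtain rfl : x = t ^ 2 - a ^ 2 := by linarith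
  rw [ht]
  have e1 : t - a - ((t ^ 2 - a ^ 2) / (2 * a) - (t ^ 2 - a ^ 2) ^ 2 / (8 * a ^ 3))
      = (a ^ 5)⁻¹ * ((t - a) ^ 3 * ((t + 3 * a) * a ^ 2 / 8)) := by
    field_simp
    ring
  have e2 : (t ^ 2 - a ^ 2) ^ 3 = (t - a) ^ 3 * (t + a) ^ 3 := by ring
  rw [e1, e2, abs_mul, abs_mul, abs_mul, abs_of_pos (by positivity : 0 < (a ^ 5)⁻¹),
    abs_of_nonneg (by positivity : 0 ≤ (t + 3 * a) * a ^ 2 / 8),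
    abs_of_nonneg (by positivity : 0 ≤ (t + a) ^ 3)]
  gcongr
  have h1 : 0 ≤ t ^ 3 := by positivity
  have h2 : 0 ≤ t ^ 2 * a := by positivity
  have h3 : 0 ≤ t * a ^ 2 := by positivity
  have h4 : 0 ≤ a ^ 3 := by positivity
  linarith [show (t + a) ^ 3 = t ^ 3 + 3 * (t ^ 2 * a) + 3 * (t * a ^ 2) + a ^ 3 by ring,
    show (t + 3 * a) * a ^ 2 = t * a ^ 2 + 3 * a ^ 3 by ring]

/-- Cauchy–Schwarz inequality for real functions in `L²`. -/
lemma integral_abs_mul_abs_le_sqrt {Ω : Type*} [MeasurableSpace Ω] {P : Measure Ω}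
    {f g : Ω → ℝ} (hf : MemLp f 2 P) (hg : MemLp g 2 P) :
    ∫ ω, |f ω| * |g ω| ∂P ≤ Real.sqrt ((∫ ω, f ω ^ 2 ∂P) * ∫ ω, g ω ^ 2 ∂P) := by
  have h := integral_mul_norm_le_Lp_mul_Lq (μ := P) (f := f) (g := g)
    Real.HolderConjugate.two_two (by simpa using hf) (by simpa using hg)
  simp only [Real.norm_eq_abs, Real.rpow_two, sq_abs, ← Real.sqrt_eq_rpow] at h
  rwa [Real.sqrt_mul (integral_nonneg fun ω => sq_nonneg _)]

/-- Quantitative second-order expansion underlying the asymptotic part of Proposition 5: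
if `Δ ≥ −κ` a.s., `E[R] = 0`, `E[R²] < ∞` and `E[Δ⁶] < ∞`, then
`|E[√(n(Δ+κ)) R] − √n E[(Δ/(2√κ) − Δ²/(8κ^{3/2})) R]| ≤ √n κ^{−5/2} √(E[Δ⁶] E[R²])`. -/
theorem sqrt_second_order_expansion_bound
    {Ω : Type*} [MeasurableSpace Ω] (P : Measure Ω) [IsProbabilityMeasure P]
    (Δ R : Ω → ℝ) (hΔmeas : Measurable Δ) (hRmeas : Measurable R)
    (κ : ℝ) (hκ : 0 < κ) (n : ℕ) (hn : 1 ≤ n)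
    (hΔκ : ∀ᵐ ω ∂P, -κ ≤ Δ ω)
    (hR0 : ∫ ω, R ω ∂P = 0)
    (hR2 : Integrable (fun ω => R ω ^ 2) P)
    (hΔ6 : Integrable (fun ω => Δ ω ^ 6) P) :
    |(∫ ω, Real.sqrt (n * (Δ ω + κ)) * R ω ∂P)
        - Real.sqrt n *
            ∫ ω, (Δ ω / (2 * Real.sqrt κ) - Δ ω ^ 2 / (8 * κ ^ ((3 : ℝ) / 2))) * R ω ∂P|
      ≤ Real.sqrt n * κ ^ (-(5 : ℝ) / 2)
          * Real.sqrt ((∫ ω, Δ ω ^ 6 ∂P) * ∫ ω, R ω ^ 2 ∂P) := by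
  obtain ⟨a, ha, rfl⟩ : ∃ a : ℝ, 0 < a ∧ κ = a ^ 2 :=
    ⟨Real.sqrt κ, Real.sqrt_pos.2 hκ, (Real.sq_sqrt hκ.le).symm⟩
  have hp3 : (a ^ 2) ^ ((3 : ℝ) / 2) = a ^ 3 := by
    rw [← Real.rpow_natCast a 2, ← Real.rpow_mul ha.le, ← Real.rpow_natCast a 3]
    norm_num
  have hp5 : (a ^ 2) ^ (-(5 : ℝ) / 2) = (a ^ 5)⁻¹ := by
    rw [← Real.rpow_natCast a 2, ← Real.rpow_mul ha.le, ← Real.rpow_natCast a 5,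
      ← Real.rpow_neg ha.le]
    norm_num
  rw [hp3, hp5, Real.sqrt_sq ha.le]
  have hR : MemLp R 2 P := (memLp_two_iff_integrable_sq hRmeas.aestronglyMeasurable).2 hR2
  have hΔ3 : MemLp (fun ω => Δ ω ^ 3) 2 P := by
    rw [memLp_two_iff_integrable_sq (by fun_prop)]
    simpa only [← pow_mul] using hΔ6
  have hΔ3abs : MemLp (fun ω => |Δ ω ^ 3|) 2 P := hΔ3.norm
  have hRabs : MemLp (fun ω => |R ω|) 2 P := hR.norm
  have hone : MemLp (fun _ : Ω => (1 : ℝ)) 2 P := memLp_const 1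
  have hmaj : MemLp (fun ω => 1 + |Δ ω ^ 3|) 2 P := hone.add hΔ3abs
  have hΔ1 : MemLp Δ 2 P := hmaj.of_le (by fun_prop) <| .of_forall fun ω => by
    rw [Real.norm_eq_abs, Real.norm_of_nonneg (by positivity), abs_pow]
    nlinarith [abs_nonneg (Δ ω), sq_nonneg (|Δ ω| - 1),
      mul_nonneg (abs_nonneg (Δ ω)) (sq_nonneg (|Δ ω| - 1))]
  have hΔ2 : MemLp (fun ω => Δ ω ^ 2) 2 P := hmaj.of_le (by fun_prop) <| .of_forall fun ω => by
    rw [Real.norm_eq_abs, Real.norm_of_nonneg (by positivity), abs_pow, abs_pow]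
    nlinarith [abs_nonneg (Δ ω), mul_nonneg (abs_nonneg (Δ ω)) (sq_nonneg (|Δ ω| - 1))]
  have hQ : MemLp (fun ω => Δ ω / (2 * a) - Δ ω ^ 2 / (8 * a ^ 3)) 2 P := by
    simp only [div_eq_mul_inv]
    exact (hΔ1.mul_const _).sub (hΔ2.mul_const _)
  have hS : MemLp (fun ω => Real.sqrt (Δ ω + a ^ 2)) 2 P := by
    rw [memLp_two_iff_integrable_sq (by fun_prop)]
    have hΔint : Integrable Δ P := hΔ1.integrable one_le_two
    have hsum : Integrable (fun ω => Δ ω + a ^ 2) P := hΔint.add (integrable_const (a ^ 2))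
    refine hsum.congr ?_
    filter_upwards [hΔκ] with ω hω
    simp [Real.sq_sqrt (by linarith : 0 ≤ Δ ω + a ^ 2)]
  have hSR : Integrable (fun ω => Real.sqrt (Δ ω + a ^ 2) * R ω) P := hS.integrable_mul hR
  have hQR : Integrable (fun ω => (Δ ω / (2 * a) - Δ ω ^ 2 / (8 * a ^ 3)) * R ω) P :=
    hQ.integrable_mul hR
  have hRint : Integrable R P := hR.integrable one_le_two
  have haR : Integrable (fun ω => a * R ω) P := hRint.const_mul a
  have hSaR : Integrable (fun ω => Real.sqrt (Δ ω + a ^ 2) * R ω - a * R ω) P := hSR.sub haR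
  have hprod : Integrable (fun ω => |Δ ω ^ 3| * |R ω|) P := hΔ3abs.integrable_mul hRabs
  have hbound := hprod.const_mul (a ^ 5)⁻¹
  have key : (∫ ω, Real.sqrt (n * (Δ ω + a ^ 2)) * R ω ∂P)
      - Real.sqrt n * ∫ ω, (Δ ω / (2 * a) - Δ ω ^ 2 / (8 * a ^ 3)) * R ω ∂P
      = Real.sqrt n * ∫ ω, (Real.sqrt (Δ ω + a ^ 2) - a
          - (Δ ω / (2 * a) - Δ ω ^ 2 / (8 * a ^ 3))) * R ω ∂P := by
    simp only [Real.sqrt_mul (Nat.cast_nonneg n), mul_assoc (Real.sqrt (n : ℝ)), sub_mul _ _ (R _)]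
    simp only [← sub_mul (_ / _) (_ / _)]
    rw [integral_const_mul, integral_sub hSaR hQR, integral_sub hSR haR,
      integral_const_mul, hR0]
    ring
  rw [key, abs_mul, abs_of_nonneg (Real.sqrt_nonneg _), mul_assoc]
  gcongr
  calc |∫ ω, (Real.sqrt (Δ ω + a ^ 2) - a
          - (Δ ω / (2 * a) - Δ ω ^ 2 / (8 * a ^ 3))) * R ω ∂P|
      ≤ ∫ ω, (a ^ 5)⁻¹ * (|Δ ω ^ 3| * |R ω|) ∂P := by
        rw [← Real.norm_eq_abs]
        refine norm_integral_le_of_norm_le hbound ?_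
        filter_upwards [hΔκ] with ω hω
        rw [Real.norm_eq_abs, abs_mul, ← mul_assoc]
        gcongr
        exact abs_sqrt_add_sq_sub_taylor_le ha hω
    _ = (a ^ 5)⁻¹ * ∫ ω, |Δ ω ^ 3| * |R ω| ∂P := integral_const_mul _ _
    _ ≤ (a ^ 5)⁻¹ * Real.sqrt ((∫ ω, Δ ω ^ 6 ∂P) * ∫ ω, R ω ^ 2 ∂P) := by
        gcongr
        simpa only [← pow_mul] using integral_abs_mul_abs_le_sqrt hΔ3 hR
end

section
/- For every real number x ≥ −1, |√(1 + x) − (1 + x/2 − x²/8)| ≤ |x|³. -/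
/-- Global second-order Taylor bound for the square root:
for every `x ≥ −1`, `|√(1 + x) − (1 + x/2 − x²/8)| ≤ |x|³`. -/
theorem sqrt_taylor_global_bound (x : ℝ) (hx : -1 ≤ x) :
    |Real.sqrt (1 + x) - (1 + x / 2 - x ^ 2 / 8)| ≤ |x| ^ 3 := by
  obtain ⟨s, hs⟩ : ∃ s, s = Real.sqrt (1 + x) := ⟨_, rfl⟩
  have hs0 : 0 ≤ s := hs ▸ Real.sqrt_nonneg _
  have hsq : s ^ 2 = 1 + x := hs ▸ Real.sq_sqrt (by linarith)
  obtain rfl : x = (s - 1) * (s + 1) := by linear_combination -hsq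
  rw [← hs]
  have hrem : s - (1 + (s - 1) * (s + 1) / 2 - ((s - 1) * (s + 1)) ^ 2 / 8)
      = (s - 1) ^ 3 * ((s + 3) / 8) := by ring
  rw [hrem, abs_mul, abs_mul, abs_pow, mul_pow, abs_of_nonneg (by positivity : 0 ≤ (s + 3) / 8),
    abs_of_nonneg (by positivity : 0 ≤ s + 1)]
  gcongr
  nlinarith [pow_nonneg hs0 2, pow_nonneg hs0 3]
end
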